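/- arXiv:2206.08838 — 4 statements merged into one kernel-verified Lean document; each statement's English description precedes it below -/
import Mathlib

section
/- For every λ > 0 and every nonzero x in the closed upper half-space {x ∈ ℝ³ : x₃ ≥ 0}, the gradient of the standard bubble is approximated by the gradient of the rescaled Newtonian potential h_λ(x) = 1/(√λ |x|): | ∇δ_{0,λ}(x) − ∇h_λ(x) | ≤ 4 / (√λ · λ|x|³), where ∇h_λ(x) = −x/(√λ |x|³). In particular | ∇(δ_{0,λ} − h_λ)(x) | ≤ C/(√λ |x|) whenever λ|x|² ≥ 1. -/
open Real

/-- The derivative of `√(c / P)` for a positive function `P`. -/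
theorem hasDerivAt_sqrt_const_div {P : ℝ → ℝ} {P' c t : ℝ} (hc : 0 ≤ c) (hP : HasDerivAt P P' t)
    (hpos : 0 < P t) :
    HasDerivAt (fun u => √(c / P u)) (-(√c * (P' / 2)) / √(P t) ^ 3) t := by
  have hS : 0 < √(P t) := Real.sqrt_pos.2 hpos
  have h := ((hP.sqrt hpos.ne').inv hS.ne').const_mul √c
  have hfun : (fun u => √(c / P u)) = fun u => √c * (√(P u))⁻¹ := by
    funext u
    rw [Real.sqrt_div hc, div_eq_mul_inv]
  rw [hfun]
  exact h.congr_deriv (by field_simp)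

/-- For `a = |u|` and `b = |v|` with `|v - u| = 1`, this says that
`|v / b³ - u / a³| ≤ 4 / a³`, squared and cleared of denominators. -/
theorem quartic_le_of_le_of_le_add_one {a b : ℝ} (ha : 0 < a) (hab : a ≤ b) (hb : b ≤ a + 1) :
    a ^ 2 * (a ^ 4 + b ^ 4 - a * b * (a ^ 2 + b ^ 2 - 1)) ≤ 16 * b ^ 4 := by
  have hb0 : 0 < b := ha.trans_le hab
  have hsq : (b - a) ^ 2 ≤ 1 := by nlinarith
  have h1 : a * b ≤ b ^ 2 := by nlinarith
  have h2 : a ^ 2 ≤ b ^ 2 := by gcongr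
  have h3 : (b - a) ^ 2 * (a ^ 2 + a * b + b ^ 2) ≤ 1 * (3 * b ^ 2) := by
    gcongr
    linarith
  have h4 : a ^ 4 + b ^ 4 - a * b * (a ^ 2 + b ^ 2 - 1) ≤ 4 * b ^ 2 := by
    linear_combination h3 + h1
  calc a ^ 2 * (a ^ 4 + b ^ 4 - a * b * (a ^ 2 + b ^ 2 - 1))
      ≤ a ^ 2 * (4 * b ^ 2) := by gcongr
    _ ≤ b ^ 2 * (4 * b ^ 2) := by gcongr
    _ ≤ 16 * b ^ 4 := by nlinarith [pow_pos hb0 4]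

/-- The gradient bound in coordinates, with `s = √λ`, `r = |x|` and `S = |λ x + e₃|`. -/
theorem sqrt_sum_sq_gradient_sub_le {s r S x y z : ℝ} (hs : 0 < s) (hr : 0 < r) (hS : 0 < S)
    (hz : 0 ≤ z) (hr2 : r ^ 2 = x ^ 2 + y ^ 2 + z ^ 2)
    (hS2 : S ^ 2 = (1 + s ^ 2 * z) ^ 2 + (s ^ 2) ^ 2 * (x ^ 2 + y ^ 2)) :
    √((-(s * (s ^ 4 * x)) / S ^ 3 - -x / (s * r ^ 3)) ^ 2 +
        (-(s * (s ^ 4 * y)) / S ^ 3 - -y / (s * r ^ 3)) ^ 2 +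
        (-(s * (s ^ 2 * (1 + s ^ 2 * z))) / S ^ 3 - -z / (s * r ^ 3)) ^ 2) ≤
      4 / (s * (s ^ 2 * r ^ 3)) := by
  have hzr : z ≤ r := by nlinarith [sq_nonneg x, sq_nonneg y]
  have hSr : S ^ 2 = (s ^ 2 * r) ^ 2 + 2 * s ^ 2 * z + 1 := by
    linear_combination hS2 - s ^ 4 * hr2
  have hle : s ^ 2 * r ≤ S := by
    apply le_of_sq_le_sq _ hS.le
    rw [hSr]
    have : 0 ≤ s ^ 2 * z := by positivity
    linarith
  have hge : S ≤ s ^ 2 * r + 1 := by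
    apply le_of_sq_le_sq _ (by positivity)
    rw [hSr]
    have : s ^ 2 * z ≤ s ^ 2 * r := by gcongr
    linarith
  have hq := quartic_le_of_le_of_le_add_one (by positivity) hle hge
  apply Real.sqrt_le_iff.2 ⟨by positivity, ?_⟩
  have hsum : (-(s * (s ^ 4 * x)) / S ^ 3 - -x / (s * r ^ 3)) ^ 2 +
        (-(s * (s ^ 4 * y)) / S ^ 3 - -y / (s * r ^ 3)) ^ 2 +
        (-(s * (s ^ 2 * (1 + s ^ 2 * z))) / S ^ 3 - -z / (s * r ^ 3)) ^ 2 =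
      (s ^ 6 * S ^ 2) / S ^ 6 + r ^ 2 / (s ^ 2 * r ^ 6) -
        s ^ 2 * (2 * (s ^ 2 * r ^ 2 + z)) / (S ^ 3 * r ^ 3) := by
    rw [hS2, hr2]
    field_simp
    ring
  have hz2 : 2 * (s ^ 2 * r ^ 2 + z) = ((s ^ 2 * r) ^ 2 + S ^ 2 - 1) / s ^ 2 := by
    rw [hSr]
    field_simp
    ring
  have hfin : (s ^ 6 * S ^ 2) / S ^ 6 + r ^ 2 / (s ^ 2 * r ^ 6) -
        s ^ 2 * (((s ^ 2 * r) ^ 2 + S ^ 2 - 1) / s ^ 2) / (S ^ 3 * r ^ 3) =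
      ((s ^ 2 * r) ^ 2 * ((s ^ 2 * r) ^ 4 + S ^ 4 -
        s ^ 2 * r * S * ((s ^ 2 * r) ^ 2 + S ^ 2 - 1))) / (s ^ 6 * r ^ 6 * S ^ 4) := by
    field_simp
  rw [hsum, hz2, hfin, div_le_iff₀ (by positivity)]
  refine hq.trans_eq ?_
  field_simp
  norm_num

/-- The gradient of the standard bubble minus that of the rescaled Newtonian potential. -/
theorem sqrt_sum_sq_deriv_bubble_sub_le {lam : ℝ} (hlam : 0 < lam) {x : Fin 3 → ℝ} (hx : x ≠ 0)
    (hx2 : 0 ≤ x 2) :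
      Real.sqrt (∑ i : Fin 3,
          ((deriv (fun t : ℝ =>
              Real.sqrt (lam / ((1 + lam * (Function.update x i t) 2) ^ 2 +
                lam ^ 2 * (((Function.update x i t) 0) ^ 2 + ((Function.update x i t) 1) ^ 2))))
              (x i)) -
            (-(x i) /
              (Real.sqrt lam * (Real.sqrt ((x 0) ^ 2 + (x 1) ^ 2 + (x 2) ^ 2)) ^ 3))) ^ 2) ≤
        4 / (Real.sqrt lam * (lam * (Real.sqrt ((x 0) ^ 2 + (x 1) ^ 2 + (x 2) ^ 2)) ^ 3)) := by
  have hr2 : 0 < x 0 ^ 2 + x 1 ^ 2 + x 2 ^ 2 := by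
    by_contra! h
    apply hx
    funext i
    fin_cases i <;> simp <;> nlinarith [sq_nonneg (x 0), sq_nonneg (x 1), sq_nonneg (x 2)]
  have hD : 0 < (1 + lam * x 2) ^ 2 + lam ^ 2 * (x 0 ^ 2 + x 1 ^ 2) := by positivity
  have hid (i : Fin 3) := hasDerivAt_id (x i)
  have h0 := hasDerivAt_sqrt_const_div hlam.le
    (((((hid 0).pow 2).add_const (x 1 ^ 2)).const_mul (lam ^ 2)).const_add
      ((1 + lam * x 2) ^ 2)) hD
  have h1 := hasDerivAt_sqrt_const_div hlam.le
    (((((hid 1).pow 2).const_add (x 0 ^ 2)).const_mul (lam ^ 2)).const_add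
      ((1 + lam * x 2) ^ 2)) hD
  have h2 := hasDerivAt_sqrt_const_div hlam.le
    (((((hid 2).const_mul lam).const_add 1).pow 2).add_const
      (lam ^ 2 * (x 0 ^ 2 + x 1 ^ 2))) hD
  have key := sqrt_sum_sq_gradient_sub_le (Real.sqrt_pos.2 hlam) (Real.sqrt_pos.2 hr2)
    (Real.sqrt_pos.2 hD) hx2 (Real.sq_sqrt hr2.le)
    (by rw [Real.sq_sqrt hD.le, Real.sq_sqrt hlam.le])
  have e4 : √lam ^ 4 = lam ^ 2 := by
    rw [show √lam ^ 4 = (√lam ^ 2) ^ 2 by ring, Real.sq_sqrt hlam.le]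
  rw [e4, Real.sq_sqrt hlam.le] at key
  rw [Fin.sum_univ_three]
  convert key using 6
  · refine (h0.congr_deriv ?_).deriv
    simp
    ring
  · refine (h1.congr_deriv ?_).deriv
    simp
    ring
  · refine (h2.congr_deriv ?_).deriv
    simp
    ring

/-- Gradient approximation of the standard bubble by the rescaled Newtonian potential
`h_λ(x) = 1/(√λ|x|)`, whose gradient is `∇h_λ(x) = −x/(√λ|x|³)`: for `λ > 0` and nonzero `x` in
the closed upper half-space, `|∇δ_{0,λ}(x) − ∇h_λ(x)| ≤ 4/(√λ · λ|x|³)`; in particular there is a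
constant `C > 0` with `|∇(δ_{0,λ} − h_λ)(x)| ≤ C/(√λ|x|)` whenever `λ|x|² ≥ 1`. -/
theorem stmt_15 :
    (∀ lam : ℝ, 0 < lam → ∀ x : Fin 3 → ℝ, x ≠ 0 → 0 ≤ x 2 →
      Real.sqrt (∑ i : Fin 3,
          ((deriv (fun t : ℝ =>
              Real.sqrt (lam / ((1 + lam * (Function.update x i t) 2) ^ 2 +
                lam ^ 2 * (((Function.update x i t) 0) ^ 2 + ((Function.update x i t) 1) ^ 2))))
              (x i)) -
            (-(x i) /
              (Real.sqrt lam * (Real.sqrt ((x 0) ^ 2 + (x 1) ^ 2 + (x 2) ^ 2)) ^ 3))) ^ 2) ≤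
        4 / (Real.sqrt lam * (lam * (Real.sqrt ((x 0) ^ 2 + (x 1) ^ 2 + (x 2) ^ 2)) ^ 3))) ∧
    (∃ C : ℝ, 0 < C ∧
      ∀ lam : ℝ, 0 < lam → ∀ x : Fin 3 → ℝ, x ≠ 0 → 0 ≤ x 2 →
        1 ≤ lam * ((x 0) ^ 2 + (x 1) ^ 2 + (x 2) ^ 2) →
        Real.sqrt (∑ i : Fin 3,
            ((deriv (fun t : ℝ =>
                Real.sqrt (lam / ((1 + lam * (Function.update x i t) 2) ^ 2 +
                  lam ^ 2 * (((Function.update x i t) 0) ^ 2 + ((Function.update x i t) 1) ^ 2))))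
                (x i)) -
              (-(x i) /
                (Real.sqrt lam * (Real.sqrt ((x 0) ^ 2 + (x 1) ^ 2 + (x 2) ^ 2)) ^ 3))) ^ 2) ≤
          C / (Real.sqrt lam * Real.sqrt ((x 0) ^ 2 + (x 1) ^ 2 + (x 2) ^ 2))) := by
  refine ⟨fun lam hlam x hx hx2 => sqrt_sum_sq_deriv_bubble_sub_le hlam hx hx2,
    4, by norm_num, fun lam hlam x hx hx2 h => ?_⟩
  refine (sqrt_sum_sq_deriv_bubble_sub_le hlam hx hx2).trans ?_
  have hr2 : 0 < x 0 ^ 2 + x 1 ^ 2 + x 2 ^ 2 := by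
    by_contra! h'
    nlinarith
  have hr := Real.sqrt_pos.2 hr2
  have hs := Real.sqrt_pos.2 hlam
  rw [← Real.sq_sqrt hr2.le] at h
  gcongr
  nlinarith
end

section
/- There exists a constant C > 0 such that for all λ₁, λ₂ > 0 and all a₁, a₂ ∈ ℝ², the critical bubble interaction integral on ℝ² satisfies ∫_{ℝ²} ( λ₁ / (1 + λ₁²|y − a₁|²) )^{3/2} ( λ₂ / (1 + λ₂²|y − a₂|²) )^{1/2} dy ≤ C ε₁₂, where ε₁₂ = ( λ₁/λ₂ + λ₂/λ₁ + λ₁λ₂|a₁ − a₂|² )^{−1/2}. -/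
open Real MeasureTheory

/-- Young-type splitting of `X⁻² Y⁻¹` into two pieces that are integrable on the plane. -/
lemma inv_sq_mul_inv_le {X Y : ℝ} (hX : 1 ≤ X) (hY : 0 < Y) :
    (X ^ 2)⁻¹ * Y⁻¹ ≤ (X ^ 3)⁻¹ + 2 * (Y * (1 + Y ^ 2))⁻¹ := by
  have hX0 : 0 < X := by linarith
  rcases le_total X Y with h | h
  · have h1 : (X ^ 2)⁻¹ * Y⁻¹ ≤ (X ^ 3)⁻¹ := by
      rw [← mul_inv]
      exact inv_anti₀ (by positivity) (by nlinarith [mul_le_mul_of_nonneg_left h (sq_nonneg X)])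
    have h2 : 0 ≤ 2 * (Y * (1 + Y ^ 2))⁻¹ := by positivity
    linarith
  · have h1 : (X ^ 2)⁻¹ * Y⁻¹ ≤ 2 * (Y * (1 + Y ^ 2))⁻¹ := by
      rw [← mul_inv, ← div_eq_mul_inv, inv_eq_one_div, div_le_div_iff₀ (by positivity)
        (by positivity)]
      have : 1 + Y ^ 2 ≤ 2 * X ^ 2 := by nlinarith
      nlinarith [mul_le_mul_of_nonneg_left this hY.le]
    have h2 : 0 ≤ (X ^ 3)⁻¹ := by positivity
    linarith

lemma sqrt_bubble_le {l₁ l₂ p q D : ℝ} (h₁ : 0 < l₁) (h₂ : 0 < l₂) (hp : 0 ≤ p) (hq : 0 < q)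
    (hD0 : 0 ≤ D) (hD : D ≤ 2 * p + 2 * q) :
    √(l₂ / (1 + l₂ ^ 2 * q)) ≤ (√(l₁ / l₂ + l₂ / l₁ + l₁ * l₂ * D))⁻¹ * √l₁ *
      (2 * (1 + √(1 + l₁ ^ 2 * p) * (l₁ * √q)⁻¹)) := by
  set X := √(1 + l₁ ^ 2 * p)
  have hX2 : X ^ 2 = 1 + l₁ ^ 2 * p := Real.sq_sqrt (by positivity)
  have hq2 : √q ^ 2 = q := Real.sq_sqrt hq.le
  have hq0 : 0 < √q := Real.sqrt_pos.2 hq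
  have hX0 : 0 ≤ X := Real.sqrt_nonneg _
  have hE : 0 < l₁ / l₂ + l₂ / l₁ + l₁ * l₂ * D := by positivity
  apply Real.sqrt_le_iff.2
  refine ⟨by positivity, ?_⟩
  have hsq : 1 + X ^ 2 * (l₁ ^ 2 * q)⁻¹ ≤ (1 + X * (l₁ * √q)⁻¹) ^ 2 := by
    have : (l₁ ^ 2 * q)⁻¹ = ((l₁ * √q)⁻¹) ^ 2 := by rw [inv_pow, mul_pow, hq2]
    rw [this]
    have : 0 ≤ X * (l₁ * √q)⁻¹ := by positivity
    nlinarith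
  rw [mul_pow, mul_pow, inv_pow, Real.sq_sqrt hE.le, Real.sq_sqrt h₁.le, mul_pow]
  calc l₂ / (1 + l₂ ^ 2 * q)
      ≤ (l₁ / l₂ + l₂ / l₁ + l₁ * l₂ * D)⁻¹ * l₁ *
          (2 ^ 2 * (1 + X ^ 2 * (l₁ ^ 2 * q)⁻¹)) := by
        rw [hX2, mul_assoc, inv_mul_eq_div, div_le_div_iff₀ (by positivity) hE]
        have e₁ : l₂ * (l₁ / l₂ + l₂ / l₁ + l₁ * l₂ * D)
            = l₁ * (1 + l₂ ^ 2 / l₁ ^ 2 + l₂ ^ 2 * D) := by field_simp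
        have e₂ : l₁ * (2 ^ 2 * (1 + (1 + l₁ ^ 2 * p) * (l₁ ^ 2 * q)⁻¹)) * (1 + l₂ ^ 2 * q)
            = l₁ * (4 * (1 + l₂ ^ 2 * q + (1 + l₁ ^ 2 * p) * (l₁ ^ 2 * q)⁻¹ +
                l₂ ^ 2 / l₁ ^ 2 + l₂ ^ 2 * p)) := by field_simp; ring
        rw [e₁, e₂]
        refine mul_le_mul_of_nonneg_left ?_ h₁.le
        have k₁ : 0 ≤ (1 + l₁ ^ 2 * p) * (l₁ ^ 2 * q)⁻¹ := by positivity
        have k₂ : 0 ≤ l₂ ^ 2 / l₁ ^ 2 := by positivity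
        have k₃ : 0 ≤ l₂ ^ 2 * p := by positivity
        have k₄ : 0 ≤ l₂ ^ 2 * q := by positivity
        nlinarith [mul_le_mul_of_nonneg_left hD (sq_nonneg l₂)]
    _ ≤ _ := by gcongr

/-- Pointwise majorant of the interaction density by two rescaled profiles. -/
lemma bubble_mul_bubble_le {l₁ l₂ p q D m n : ℝ} (h₁ : 0 < l₁) (h₂ : 0 < l₂)
    (hD0 : 0 ≤ D) (hD : D ≤ 2 * p + 2 * q)
    (hm : m ^ 2 ≤ l₁ ^ 2 * p) (hn : 0 < n) (hnq : n ^ 2 ≤ l₁ ^ 2 * q) :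
    (l₁ / (1 + l₁ ^ 2 * p)) ^ ((3 : ℝ) / 2) * (l₂ / (1 + l₂ ^ 2 * q)) ^ ((1 : ℝ) / 2) ≤
      (l₁ / l₂ + l₂ / l₁ + l₁ * l₂ * D) ^ (-(1 : ℝ) / 2) *
        (l₁ ^ 2 * (4 * (1 + m ^ 2) ^ (-(3 : ℝ) / 2) + 4 * (n * (1 + n ^ 2))⁻¹)) := by
  have hp : 0 ≤ p := nonneg_of_mul_nonneg_right ((sq_nonneg m).trans hm) (by positivity)
  have hq : 0 < q := pos_of_mul_pos_right ((pow_pos hn 2).trans_le hnq) (by positivity)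
  have hE : 0 < l₁ / l₂ + l₂ / l₁ + l₁ * l₂ * D := by positivity
  have r₃ : ∀ x : ℝ, 0 ≤ x → x ^ ((3 : ℝ) / 2) = √x ^ 3 := fun x hx => by
    rw [Real.sqrt_eq_rpow, ← Real.rpow_natCast, ← Real.rpow_mul hx]; norm_num
  have s₃ : (1 + m ^ 2) ^ (-(3 : ℝ) / 2) = (√(1 + m ^ 2) ^ 3)⁻¹ := by
    rw [neg_div, Real.rpow_neg (by positivity), r₃ _ (by positivity)]
  have s₁ : (l₁ / l₂ + l₂ / l₁ + l₁ * l₂ * D) ^ (-(1 : ℝ) / 2)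
      = (√(l₁ / l₂ + l₂ / l₁ + l₁ * l₂ * D))⁻¹ := by
    rw [neg_div, Real.rpow_neg hE.le, Real.sqrt_eq_rpow]
  rw [r₃ _ (by positivity), ← Real.sqrt_eq_rpow, s₃, s₁, Real.sqrt_div h₁.le]
  have hb := sqrt_bubble_le h₁ h₂ hp hq hD0 hD
  set X := √(1 + l₁ ^ 2 * p)
  set e := (√(l₁ / l₂ + l₂ / l₁ + l₁ * l₂ * D))⁻¹
  have hX1 : 1 ≤ X := Real.one_le_sqrt.2 (by nlinarith [sq_nonneg m])
  have hX0 : 0 < X := by linarith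
  have hY0 : 0 < l₁ * √q := mul_pos h₁ (Real.sqrt_pos.2 hq)
  have hY : n ≤ l₁ * √q := by
    refine le_of_sq_le_sq ?_ hY0.le
    rwa [mul_pow, Real.sq_sqrt hq.le]
  have hmX : √(1 + m ^ 2) ≤ X := Real.sqrt_le_sqrt (by linarith)
  have hm0 : 0 < √(1 + m ^ 2) := by positivity
  have hl : √l₁ ^ 4 = l₁ ^ 2 := by
    rw [show √l₁ ^ 4 = (√l₁ ^ 2) ^ 2 by ring, Real.sq_sqrt h₁.le]
  have hy := inv_sq_mul_inv_le hX1 hY0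
  have he : 0 ≤ e := by positivity
  calc (√l₁ / X) ^ 3 * √(l₂ / (1 + l₂ ^ 2 * q))
      ≤ (√l₁ / X) ^ 3 * (e * √l₁ * (2 * (1 + X * (l₁ * √q)⁻¹))) := by gcongr
    _ = e * (√l₁ ^ 4 * (2 * ((X ^ 3)⁻¹ + (X ^ 2)⁻¹ * (l₁ * √q)⁻¹))) := by field_simp
    _ ≤ e * (l₁ ^ 2 * (2 * ((X ^ 3)⁻¹ +
          ((X ^ 3)⁻¹ + 2 * (l₁ * √q * (1 + (l₁ * √q) ^ 2))⁻¹)))) := by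
        rw [hl]; gcongr
    _ = e * (l₁ ^ 2 * (4 * (X ^ 3)⁻¹ + 4 * (l₁ * √q * (1 + (l₁ * √q) ^ 2))⁻¹)) := by ring
    _ ≤ _ := by gcongr

lemma integrable_inv_norm_mul_one_add_norm_sq :
    Integrable (fun w : Fin 2 → ℝ => (‖w‖ * (1 + ‖w‖ ^ 2))⁻¹) := by
  refine (integrable_fun_norm_addHaar (volume : Measure (Fin 2 → ℝ))
    (f := fun r : ℝ => (r * (1 + r ^ 2))⁻¹)).2 ?_
  refine (integrable_inv_one_add_sq.integrableOn (s := Set.Ioi (0 : ℝ))).congr_fun ?_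
    measurableSet_Ioi
  intro r hr
  have hr : 0 < r := hr
  simp
  field_simp

lemma norm_sq_le_sum_sq (v : Fin 2 → ℝ) : ‖v‖ ^ 2 ≤ v 0 ^ 2 + v 1 ^ 2 := by
  have : ‖v‖ ≤ √(v 0 ^ 2 + v 1 ^ 2) := by
    refine (pi_norm_le_iff_of_nonneg (Real.sqrt_nonneg _)).2 fun i => ?_
    refine Real.le_sqrt_of_sq_le ?_
    rw [Real.norm_eq_abs, sq_abs]
    fin_cases i <;> simp <;> positivity
  calc ‖v‖ ^ 2 ≤ √(v 0 ^ 2 + v 1 ^ 2) ^ 2 := by gcongr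
    _ = _ := Real.sq_sqrt (by positivity)

lemma integral_comp_smul_sub (f : (Fin 2 → ℝ) → ℝ) {l : ℝ} (hl : 0 < l) (a : Fin 2 → ℝ) :
    l ^ 2 * ∫ y, f (l • (y - a)) = ∫ y, f y := by
  rw [integral_sub_right_eq_self (fun y => f (l • y)) a, Measure.integral_comp_smul]
  have : |(l ^ 2)⁻¹| = (l ^ 2)⁻¹ := abs_of_nonneg (by positivity)
  simp only [Module.finrank_fin_fun, this, smul_eq_mul]
  field_simp

lemma MeasureTheory.Integrable.comp_smul_sub {f : (Fin 2 → ℝ) → ℝ} (hf : Integrable f) {l : ℝ}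
    (hl : 0 < l) (a : Fin 2 → ℝ) : Integrable fun y => f (l • (y - a)) :=
  (hf.comp_smul hl.ne').comp_sub_right a

/-- Critical bubble interaction estimate on `ℝ²`: there is `C > 0` such that for all
`λ₁, λ₂ > 0` and `a₁, a₂ ∈ ℝ²`,
`∫_{ℝ²} (λ₁/(1+λ₁²|y−a₁|²))^{3/2} (λ₂/(1+λ₂²|y−a₂|²))^{1/2} dy ≤ C ε₁₂`, where
`ε₁₂ = (λ₁/λ₂ + λ₂/λ₁ + λ₁λ₂|a₁−a₂|²)^{−1/2}`. -/
theorem stmt_16 :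
    ∃ C : ℝ, 0 < C ∧
      ∀ lam₁ lam₂ : ℝ, 0 < lam₁ → 0 < lam₂ → ∀ a₁ a₂ : Fin 2 → ℝ,
        (∫ y : Fin 2 → ℝ,
            (lam₁ / (1 + lam₁ ^ 2 * ((y 0 - a₁ 0) ^ 2 + (y 1 - a₁ 1) ^ 2))) ^ ((3 : ℝ) / 2) *
              (lam₂ / (1 + lam₂ ^ 2 * ((y 0 - a₂ 0) ^ 2 + (y 1 - a₂ 1) ^ 2))) ^ ((1 : ℝ) / 2)) ≤
          C * (lam₁ / lam₂ + lam₂ / lam₁ +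
              lam₁ * lam₂ * ((a₁ 0 - a₂ 0) ^ 2 + (a₁ 1 - a₂ 1) ^ 2)) ^ (-(1 : ℝ) / 2) := by
  set G : (Fin 2 → ℝ) → ℝ := fun z => 4 * (1 + ‖z‖ ^ 2) ^ (-(3 : ℝ) / 2) with hG
  set H : (Fin 2 → ℝ) → ℝ := fun w => 4 * (‖w‖ * (1 + ‖w‖ ^ 2))⁻¹ with hH
  have iG : Integrable G :=
    (integrable_rpow_neg_one_add_norm_sq (by norm_num [Module.finrank_fin_fun])).const_mul 4
  have iH : Integrable H := integrable_inv_norm_mul_one_add_norm_sq.const_mul 4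
  have nG : 0 ≤ ∫ z, G z := integral_nonneg fun z => by simp only [hG, Pi.zero_apply]; positivity
  have nH : 0 ≤ ∫ z, H z := integral_nonneg fun z => by simp only [hH, Pi.zero_apply]; positivity
  refine ⟨(∫ z, G z) + (∫ z, H z) + 1, by positivity, fun l₁ l₂ h₁ h₂ a₁ a₂ => ?_⟩
  set E := l₁ / l₂ + l₂ / l₁ + l₁ * l₂ * ((a₁ 0 - a₂ 0) ^ 2 + (a₁ 1 - a₂ 1) ^ 2)
  have hE0 : 0 < E := by positivity
  have jG := iG.comp_smul_sub h₁ a₁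
  have jH := iH.comp_smul_sub h₁ a₂
  calc _ ≤ ∫ y, E ^ (-(1 : ℝ) / 2) * (l₁ ^ 2 * (G (l₁ • (y - a₁)) + H (l₁ • (y - a₂)))) := by
        refine integral_mono_of_nonneg (.of_forall fun y => by dsimp only; positivity)
          (((jG.add jH).const_mul _).const_mul _) ?_
        filter_upwards [Measure.ae_ne volume a₂] with y hy
        refine bubble_mul_bubble_le h₁ h₂ (by positivity) ?_ ?_ ?_ ?_
        · nlinarith [sq_nonneg ((y 0 - a₁ 0) + (y 0 - a₂ 0)),
            sq_nonneg ((y 1 - a₁ 1) + (y 1 - a₂ 1))]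
        · refine (norm_sq_le_sum_sq _).trans_eq ?_
          simp; ring
        · exact norm_pos_iff.2 (smul_ne_zero h₁.ne' (sub_ne_zero.2 hy))
        · refine (norm_sq_le_sum_sq _).trans_eq ?_
          simp; ring
    _ = ((∫ z, G z) + ∫ z, H z) * E ^ (-(1 : ℝ) / 2) := by
        rw [integral_const_mul, integral_const_mul, integral_add jG jH, mul_add,
          integral_comp_smul_sub G h₁, integral_comp_smul_sub H h₁, mul_comm]
    _ ≤ _ := mul_le_mul_of_nonneg_right (by linarith) (by positivity)
end

section
/- There exists a constant C > 0 such that for all λ₁, λ₂ > 0 and all a₁, a₂ ∈ ℝ², the balanced high-order bubble interaction integral on ℝ² satisfies ∫_{ℝ²} ( λ₁ / (1 + λ₁²|y − a₁|²) ) ( λ₂ / (1 + λ₂²|y − a₂|²) ) dy ≤ C ε₁₂² log(1/ε₁₂), where ε₁₂ = ( λ₁/λ₂ + λ₂/λ₁ + λ₁λ₂|a₁ − a₂|² )^{−1/2} (note ε₁₂ ≤ 2^{−1/2} < 1, so log(1/ε₁₂) > 0). -/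
open Real MeasureTheory

theorem hasDerivAt_log_ratio {α K : ℝ} (hα : 0 < α) (hK : 0 < K) (r : ℝ) :
    HasDerivAt (fun r : ℝ => 1 / (2 * K) * Real.log ((α + r ^ 2) / (α + K + r ^ 2)))
      (r * (1 / ((α + r ^ 2) * (α + K + r ^ 2)))) r := by
  have h₁ : 0 < α + r ^ 2 := by positivity
  have h₂ : 0 < α + K + r ^ 2 := by positivity
  have hd (c : ℝ) : HasDerivAt (fun r : ℝ => c + r ^ 2) (2 * r) r := by
    simpa using (hasDerivAt_pow 2 r).const_add c
  have h := (((hd α).div (hd (α + K)) h₂.ne').log (div_pos h₁ h₂).ne').const_mul (1 / (2 * K))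
  refine h.congr_deriv ?_
  simp only [Pi.div_apply]
  field_simp
  ring

theorem tendsto_log_ratio_atTop {α K : ℝ} (hα : 0 < α) (hK : 0 < K) :
    Filter.Tendsto (fun r : ℝ => 1 / (2 * K) * Real.log ((α + r ^ 2) / (α + K + r ^ 2)))
      Filter.atTop (nhds 0) := by
  have hinf : Filter.Tendsto (fun r : ℝ => α + K + r ^ 2) Filter.atTop Filter.atTop :=
    Filter.tendsto_atTop_add_const_left _ _ (Filter.tendsto_pow_atTop two_ne_zero)
  have hratio : Filter.Tendsto (fun r : ℝ => (α + r ^ 2) / (α + K + r ^ 2))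
      Filter.atTop (nhds 1) := by
    have h := (hinf.const_div_atTop K).const_sub 1
    rw [sub_zero] at h
    refine h.congr fun r => ?_
    have : 0 < α + K + r ^ 2 := by positivity
    field_simp
    ring
  simpa using (hratio.log one_ne_zero).const_mul (1 / (2 * K))

/-- The integral of `1 / ((α + |y - a|²)(α + K + |y - a|²))` over the plane, up to the area of the
unit disc. -/
theorem integrable_and_integral_inv_mul_inv {α K : ℝ} (hα : 0 < α) (hK : 0 < K)
    (a : Fin 2 → ℝ) :
    Integrable (fun y : Fin 2 → ℝ => 1 / ((α + ((y 0 - a 0) ^ 2 + (y 1 - a 1) ^ 2)) *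
      (α + K + ((y 0 - a 0) ^ 2 + (y 1 - a 1) ^ 2)))) ∧
    ∫ y : Fin 2 → ℝ, 1 / ((α + ((y 0 - a 0) ^ 2 + (y 1 - a 1) ^ 2)) *
      (α + K + ((y 0 - a 0) ^ 2 + (y 1 - a 1) ^ 2))) =
      volume.real (Metric.ball (0 : EuclideanSpace ℝ (Fin 2)) 1) *
        (Real.log (1 + K / α) / K) := by
  set f : ℝ → ℝ := fun r => 1 / ((α + r ^ 2) * (α + K + r ^ 2)) with hf
  have hpos : ∀ r ∈ Set.Ioi (0 : ℝ), 0 ≤ r * f r := fun r hr => by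
    have : 0 < r := hr
    positivity
  have hint : IntegrableOn (fun r => r * f r) (Set.Ioi 0) :=
    integrableOn_Ioi_deriv_of_nonneg' (fun r _ => hasDerivAt_log_ratio hα hK r) hpos
      (tendsto_log_ratio_atTop hα hK)
  have hval : ∫ r in Set.Ioi 0, r * f r = Real.log (1 + K / α) / (2 * K) := by
    rw [integral_Ioi_of_hasDerivAt_of_nonneg' (fun r _ => hasDerivAt_log_ratio hα hK r) hpos
      (tendsto_log_ratio_atTop hα hK)]
    have : 1 + K / α = (α / (α + K))⁻¹ := by field_simp
    rw [this, Real.log_inv]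
    simp only [ne_eq, OfNat.ofNat_ne_zero, not_false_eq_true, zero_pow, add_zero]
    ring
  have hE : Integrable (fun x : EuclideanSpace ℝ (Fin 2) => f ‖x‖) := by
    rw [integrable_fun_norm_addHaar volume (f := f)]
    simpa using hint
  have hEval : ∫ x : EuclideanSpace ℝ (Fin 2), f ‖x‖ =
      volume.real (Metric.ball (0 : EuclideanSpace ℝ (Fin 2)) 1) *
        (Real.log (1 + K / α) / K) := by
    rw [integral_fun_norm_addHaar volume f]
    simp only [finrank_euclideanSpace, Fintype.card_fin, Nat.add_one_sub_one, pow_one,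
      smul_eq_mul, nsmul_eq_mul, hval]
    push_cast
    field_simp
  have hmp := PiLp.volume_preserving_toLp (Fin 2)
  have hemb : MeasurableEmbedding (WithLp.toLp 2 : (Fin 2 → ℝ) → EuclideanSpace ℝ (Fin 2)) :=
    (MeasurableEquiv.toLp 2 (Fin 2 → ℝ)).measurableEmbedding
  have hfun : (fun y : Fin 2 → ℝ => 1 / ((α + ((y 0 - a 0) ^ 2 + (y 1 - a 1) ^ 2)) *
      (α + K + ((y 0 - a 0) ^ 2 + (y 1 - a 1) ^ 2)))) =
      fun y => (fun z : Fin 2 → ℝ => f ‖(WithLp.toLp 2 z : EuclideanSpace ℝ (Fin 2))‖)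
        (y - a) := by
    funext y
    simp [hf, EuclideanSpace.norm_sq_eq, Fin.sum_univ_two]
  rw [hfun]
  refine ⟨((hmp.integrable_comp_emb hemb).mpr hE).comp_sub_right a, ?_⟩
  rw [integral_sub_right_eq_self
    (fun z : Fin 2 → ℝ => f ‖(WithLp.toLp 2 z : EuclideanSpace ℝ (Fin 2))‖) a,
    hmp.integral_comp hemb (fun x => f ‖x‖), hEval]

theorem inv_mul_inv_le {α β u v d : ℝ} (hα : 0 < α) (hβ : 0 < β) (hu : 0 ≤ u) (hv : 0 ≤ v)
    (hd : 0 ≤ d) (hduv : d ≤ 2 * u + 2 * v) :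
    1 / ((α + u) * (β + v)) ≤
      3 * (1 / ((α + u) * (α + (α + β + d) + u))) +
        3 * (1 / ((β + v) * (β + (α + β + d) + v))) := by
  have hA : 0 < α + u := by positivity
  have hB : 0 < β + v := by positivity
  have hsplit : 1 / ((α + u) * (β + v)) =
      1 / ((α + u) * (α + u + (β + v))) + 1 / ((β + v) * (α + u + (β + v))) := by
    field_simp
    ring
  rw [hsplit]
  have key : ∀ x w : ℝ, 0 < x → 0 < w → w ≤ 3 * (α + u + (β + v)) →
      1 / (x * (α + u + (β + v))) ≤ 3 * (1 / (x * w)) := by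
    intro x w hx hw hle
    rw [mul_one_div, div_le_div_iff₀ (by positivity) (by positivity)]
    nlinarith
  exact add_le_add (key _ _ hA (by positivity) (by linarith))
    (key _ _ hB (by positivity) (by linarith))

theorem log_one_add_div_le {α β K S : ℝ} (hα : 0 < α) (hβ : 0 < β) (hβK : β ≤ K) (hS : 2 ≤ S)
    (hSK : S ^ 2 * (α * β) = K ^ 2) : Real.log (1 + K / α) ≤ 3 * Real.log S := by
  have hK : 0 < K := hβ.trans_le hβK
  have h : K / α ≤ S ^ 2 := by
    rw [div_le_iff₀ hα]
    refine le_of_mul_le_mul_right ?_ hβ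
    nlinarith
  rw [show (3 : ℝ) * Real.log S = Real.log (S ^ 3) by simp]
  exact Real.log_le_log (by positivity) (by nlinarith [sq_nonneg S])

/-- Balanced high-order bubble interaction estimate on `ℝ²`: there is `C > 0` such that for all
`λ₁, λ₂ > 0` and `a₁, a₂ ∈ ℝ²`,
`∫_{ℝ²} (λ₁/(1+λ₁²|y−a₁|²)) (λ₂/(1+λ₂²|y−a₂|²)) dy ≤ C ε₁₂² log(1/ε₁₂)`, where
`ε₁₂ = (λ₁/λ₂ + λ₂/λ₁ + λ₁λ₂|a₁−a₂|²)^{−1/2}`. -/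
theorem stmt_17 :
    ∃ C : ℝ, 0 < C ∧
      ∀ lam₁ lam₂ : ℝ, 0 < lam₁ → 0 < lam₂ → ∀ a₁ a₂ : Fin 2 → ℝ,
        (∫ y : Fin 2 → ℝ,
            (lam₁ / (1 + lam₁ ^ 2 * ((y 0 - a₁ 0) ^ 2 + (y 1 - a₁ 1) ^ 2))) *
              (lam₂ / (1 + lam₂ ^ 2 * ((y 0 - a₂ 0) ^ 2 + (y 1 - a₂ 1) ^ 2)))) ≤
          C * ((lam₁ / lam₂ + lam₂ / lam₁ +
                lam₁ * lam₂ * ((a₁ 0 - a₂ 0) ^ 2 + (a₁ 1 - a₂ 1) ^ 2)) ^ (-(1 : ℝ) / 2)) ^ 2 *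
            Real.log (1 / ((lam₁ / lam₂ + lam₂ / lam₁ +
              lam₁ * lam₂ * ((a₁ 0 - a₂ 0) ^ 2 + (a₁ 1 - a₂ 1) ^ 2)) ^ (-(1 : ℝ) / 2))) := by
  set V := volume.real (Metric.ball (0 : EuclideanSpace ℝ (Fin 2)) 1) with hV
  have hVpos : 0 < V := ENNReal.toReal_pos (Metric.measure_ball_pos _ _ one_pos).ne'
    measure_ball_lt_top.ne
  refine ⟨36 * V, by positivity, ?_⟩
  intro l₁ l₂ h₁ h₂ a₁ a₂
  set d := (a₁ 0 - a₂ 0) ^ 2 + (a₁ 1 - a₂ 1) ^ 2 with hd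
  set S := l₁ / l₂ + l₂ / l₁ + l₁ * l₂ * d with hS
  set α := 1 / l₁ ^ 2 with hα
  set β := 1 / l₂ ^ 2 with hβ
  have hd0 : 0 ≤ d := by positivity
  have hα0 : 0 < α := by positivity
  have hβ0 : 0 < β := by positivity
  set K := α + β + d with hK
  have hK0 : 0 < K := by positivity
  have hSK : S = l₁ * l₂ * K := by
    rw [hS, hK, hα, hβ]
    field_simp
    ring
  have hS2 : 2 ≤ S := by
    have hsum : 2 ≤ l₁ / l₂ + l₂ / l₁ := by
      rw [div_add_div _ _ h₂.ne' h₁.ne', le_div_iff₀ (by positivity)]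
      nlinarith [sq_nonneg (l₁ - l₂)]
    have : 0 ≤ l₁ * l₂ * d := by positivity
    linarith
  have hS0 : 0 < S := by linarith
  have hSαβ : S ^ 2 * (α * β) = K ^ 2 := by
    rw [hSK, hα, hβ]
    field_simp
  have hrhs : 36 * V * (S ^ (-(1 : ℝ) / 2)) ^ 2 * Real.log (1 / S ^ (-(1 : ℝ) / 2)) =
      18 * V * Real.log S / S := by
    have hsq : (S ^ (-(1 : ℝ) / 2)) ^ 2 = S⁻¹ := by
      rw [← Real.rpow_natCast, ← Real.rpow_mul hS0.le]
      norm_num [Real.rpow_neg_one]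
    rw [hsq, one_div, Real.log_inv, Real.log_rpow hS0]
    field_simp
    ring
  rw [hrhs]
  clear_value V S α β K d
  obtain ⟨hi₁, he₁⟩ := integrable_and_integral_inv_mul_inv hα0 hK0 a₁
  obtain ⟨hi₂, he₂⟩ := integrable_and_integral_inv_mul_inv hβ0 hK0 a₂
  have hbound := integral_mono_of_nonneg (μ := (volume : Measure (Fin 2 → ℝ)))
    (f := fun y => (l₁ / (1 + l₁ ^ 2 * ((y 0 - a₁ 0) ^ 2 + (y 1 - a₁ 1) ^ 2))) *
      (l₂ / (1 + l₂ ^ 2 * ((y 0 - a₂ 0) ^ 2 + (y 1 - a₂ 1) ^ 2))))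
    (Filter.Eventually.of_forall fun y => by dsimp only [Pi.zero_apply]; positivity)
    (((hi₁.const_mul 3).add (hi₂.const_mul 3)).const_mul (1 / (l₁ * l₂)))
    (Filter.Eventually.of_forall fun y => by
      have hle := inv_mul_inv_le hα0 hβ0
        (u := (y 0 - a₁ 0) ^ 2 + (y 1 - a₁ 1) ^ 2) (v := (y 0 - a₂ 0) ^ 2 + (y 1 - a₂ 1) ^ 2)
        (by positivity) (by positivity) hd0
        (by rw [hd]; nlinarith [sq_nonneg (y 0 - a₁ 0 + (y 0 - a₂ 0)),
          sq_nonneg (y 1 - a₁ 1 + (y 1 - a₂ 1))])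
      rw [← hK] at hle
      refine le_trans (le_of_eq ?_)
        (mul_le_mul_of_nonneg_left hle (by positivity : 0 ≤ 1 / (l₁ * l₂)))
      rw [hα, hβ]
      field_simp)
  refine hbound.trans ?_
  rw [← hV] at he₁ he₂
  simp only [Pi.add_apply]
  rw [integral_const_mul, integral_add (hi₁.const_mul 3) (hi₂.const_mul 3), integral_const_mul,
    integral_const_mul, he₁, he₂]
  have hl₁ := log_one_add_div_le hα0 hβ0 (by linarith : β ≤ K) hS2 hSαβ
  have hl₂ := log_one_add_div_le hβ0 hα0 (by linarith : α ≤ K) hS2 (by rw [mul_comm β, hSαβ])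
  calc 1 / (l₁ * l₂) * (3 * (V * (Real.log (1 + K / α) / K)) +
        3 * (V * (Real.log (1 + K / β) / K)))
      ≤ 1 / (l₁ * l₂) * (3 * (V * (3 * Real.log S / K)) + 3 * (V * (3 * Real.log S / K))) := by
        gcongr
    _ = 18 * V * Real.log S / S := by
        rw [mul_div_assoc (18 * V), show Real.log S / S = Real.log S / (l₁ * l₂ * K) by rw [← hSK]]
        field_simp
        ring
end

section
/- Let α, β be real numbers with α + β = 4 and α > 2 > β > 1. Then there exists a constant C > 0 (depending only on β) such that for all λ₁ ≥ λ₂ > 0 and all a₁, a₂ ∈ ℝ², the unbalanced high-order bubble interaction integral on ℝ² satisfies ∫_{ℝ²} ( λ₁ / (1 + λ₁²|y − a₁|²) )^{α/2} ( λ₂ / (1 + λ₂²|y − a₂|²) )^{β/2} dy ≤ C ε₁₂^{β}, where ε₁₂ = ( λ₁/λ₂ + λ₂/λ₁ + λ₁λ₂|a₁ − a₂|² )^{−1/2}. -/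
open Real MeasureTheory

/-- If `D / B` is bounded by `4 * max 1 (A / W)`, then multiplying `A ^ (-p)` by the `q`-th power
of `D / B` costs at most a constant and an additional `W ^ (-p)`. -/
theorem rpow_neg_mul_div_rpow_le {p q A B D W : ℝ} (hq : 0 ≤ q) (hqp : q ≤ p) (hA : 0 < A)
    (hB : 0 < B) (hD : 0 ≤ D) (hW : 0 < W) (h : D ≤ 4 * B ∨ W ≤ A ∧ D * W ≤ 4 * (A * B)) :
    A ^ (-p) * (D / B) ^ q ≤ 4 ^ q * (A ^ (-p) + W ^ (-p)) := by
  have hAp : 0 < A ^ (-p) := rpow_pos_of_pos hA _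
  have hWp : 0 < W ^ (-p) := rpow_pos_of_pos hW _
  have h4 : (0 : ℝ) < 4 ^ q := rpow_pos_of_pos (by norm_num) _
  rcases h with h | ⟨hWA, h⟩
  · have h1 : (D / B) ^ q ≤ 4 ^ q :=
      rpow_le_rpow (by positivity) ((div_le_iff₀ hB).2 h) hq
    nlinarith [mul_le_mul_of_nonneg_left h1 hAp.le, mul_pos h4 hWp]
  · have h1 : (D / B) ^ q ≤ (4 * (A / W)) ^ q := by
      refine rpow_le_rpow (by positivity) ?_ hq
      rw [← mul_div_assoc, div_le_div_iff₀ hB hW]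
      linarith
    have h2 : A ^ (-p) * (4 * (A / W)) ^ q = 4 ^ q * (A ^ (q - p) * W ^ (-q)) := by
      rw [mul_rpow (by norm_num) (by positivity), div_rpow hA.le hW.le, rpow_neg hW.le q,
        sub_eq_add_neg, rpow_add hA]
      ring
    have h3 : A ^ (q - p) * W ^ (-q) ≤ W ^ (-p) := by
      calc A ^ (q - p) * W ^ (-q) ≤ W ^ (q - p) * W ^ (-q) := by
            gcongr ?_ * _
            exact rpow_le_rpow_of_nonpos hW hWA (by linarith)
        _ = W ^ (-p) := by rw [← rpow_add hW]; ring_nf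
    calc A ^ (-p) * (D / B) ^ q ≤ A ^ (-p) * (4 * (A / W)) ^ q := by gcongr
      _ = 4 ^ q * (A ^ (q - p) * W ^ (-q)) := h2
      _ ≤ 4 ^ q * (A ^ (-p) + W ^ (-p)) := by gcongr; linarith

/-- Pointwise bound of the product of two bubbles by the interaction parameter times a sum of two
integrable profiles with the larger concentration `u`. Here `r`, `s`, `d` are the squared distances
from the integration point to the two centres and between the centres. -/
theorem bubble_mul_bubble_le_s18 {p q u v r s d : ℝ} (hq : 0 ≤ q) (hqp : q ≤ p) (hpq : p + q = 2)
    (hv : 0 < v) (hvu : v ≤ u) (hr : 0 ≤ r) (hs : 0 ≤ s) (hd : 0 ≤ d) (htri : d ≤ 2 * r + 2 * s) :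
    (u / (1 + u ^ 2 * r)) ^ p * (v / (1 + v ^ 2 * s)) ^ q ≤
      4 ^ q * (u / v + v / u + u * v * d) ^ (-q) *
        (u ^ 2 * ((1 + u ^ 2 * r) ^ (-p) + (1 + u ^ 2 * s) ^ (-p))) := by
  have hu : 0 < u := hv.trans_le hvu
  set E := u / v + v / u + u * v * d with hE
  have hEpos : 0 < E := by positivity
  have hA : 0 < 1 + u ^ 2 * r := by positivity
  have hB : 0 < 1 + v ^ 2 * s := by positivity
  have hW : 0 < 1 + u ^ 2 * s := by positivity
  have hvE : v * E = u * (1 + (v / u) ^ 2 + v ^ 2 * d) := by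
    rw [hE]; field_simp
  have ht : (v / u) ^ 2 ≤ 1 := by
    rw [div_pow, div_le_one (by positivity)]; gcongr
  have htu : (v / u) ^ 2 * u ^ 2 = v ^ 2 := by field_simp
  have ht0 : 0 < (v / u) ^ 2 := by positivity
  set D := 1 + (v / u) ^ 2 + v ^ 2 * d with hD
  have hDpos : 0 < D := by positivity
  have hD1 : D ≤ 2 * ((v / u) ^ 2 * (1 + u ^ 2 * r)) + 2 * (1 + v ^ 2 * s) := by
    have : v ^ 2 * d ≤ v ^ 2 * (2 * r + 2 * s) := by gcongr
    have h2 : (v / u) ^ 2 * (1 + u ^ 2 * r) = (v / u) ^ 2 + v ^ 2 * r := by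
      rw [← htu]; ring
    rw [h2]; linarith
  have hWB : (v / u) ^ 2 * (1 + u ^ 2 * s) ≤ 1 + v ^ 2 * s := by
    have : (v / u) ^ 2 * (1 + u ^ 2 * s) = (v / u) ^ 2 + v ^ 2 * s := by
      rw [← htu]; ring
    linarith
  have key := rpow_neg_mul_div_rpow_le (p := p) hq hqp hA hB hDpos.le hW (by
    by_cases h1 : D ≤ 4 * (1 + v ^ 2 * s)
    · exact Or.inl h1
    · have h2 : 1 + v ^ 2 * s ≤ (v / u) ^ 2 * (1 + u ^ 2 * r) := by linarith
      refine Or.inr ⟨le_of_mul_le_mul_left (hWB.trans h2) ht0, ?_⟩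
      have h3 : D ≤ 4 * ((v / u) ^ 2 * (1 + u ^ 2 * r)) := by linarith
      calc D * (1 + u ^ 2 * s) ≤ 4 * ((v / u) ^ 2 * (1 + u ^ 2 * r)) * (1 + u ^ 2 * s) := by gcongr
        _ = 4 * ((1 + u ^ 2 * r) * ((v / u) ^ 2 * (1 + u ^ 2 * s))) := by ring
        _ ≤ _ := by gcongr)
  have hid : (u / (1 + u ^ 2 * r)) ^ p * (v / (1 + v ^ 2 * s)) ^ q =
      E ^ (-q) * (u ^ 2 * ((1 + u ^ 2 * r) ^ (-p) * (D / (1 + v ^ 2 * s)) ^ q)) := by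
    have h1 : v = u * D * E⁻¹ := by rw [← hvE]; field_simp
    have h2 : v / (1 + v ^ 2 * s) = u * (D / (1 + v ^ 2 * s)) * E⁻¹ := by
      calc v / (1 + v ^ 2 * s) = (u * D * E⁻¹) / (1 + v ^ 2 * s) := by rw [← h1]
        _ = _ := by ring
    have h3 : u ^ p * u ^ q = u ^ 2 := by rw [← rpow_add hu, hpq, rpow_two]
    rw [h2, mul_rpow (by positivity) (by positivity), mul_rpow hu.le (by positivity),
      inv_rpow hEpos.le, ← rpow_neg hEpos.le, div_rpow hu.le hA.le, rpow_neg hA.le, ← h3]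
    ring
  rw [hid]
  have hEq : 0 < E ^ (-q) := rpow_pos_of_pos hEpos _
  calc _ ≤ E ^ (-q) * (u ^ 2 * (4 ^ q * ((1 + u ^ 2 * r) ^ (-p) + (1 + u ^ 2 * s) ^ (-p)))) := by
        gcongr
    _ = _ := by ring

theorem sq_norm_fin_two_le (x : Fin 2 → ℝ) : ‖x‖ ^ 2 ≤ x 0 ^ 2 + x 1 ^ 2 := by
  have h : ‖x‖ ≤ √(x 0 ^ 2 + x 1 ^ 2) := by
    rw [pi_norm_le_iff_of_nonneg (sqrt_nonneg _), Fin.forall_fin_two]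
    exact ⟨abs_le_sqrt (by nlinarith [sq_nonneg (x 1)]),
      abs_le_sqrt (by nlinarith [sq_nonneg (x 0)])⟩
  calc ‖x‖ ^ 2 ≤ √(x 0 ^ 2 + x 1 ^ 2) ^ 2 := by gcongr
    _ = _ := sq_sqrt (by positivity)

/-- A planar bubble profile in the Euclidean norm is dominated by its sup-norm counterpart. -/
theorem rpow_neg_le_sup_norm {p : ℝ} (hp : 0 ≤ p) (u : ℝ) (y a : Fin 2 → ℝ) :
    (1 + u ^ 2 * ((y 0 - a 0) ^ 2 + (y 1 - a 1) ^ 2)) ^ (-p) ≤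
      (1 + ‖u • (y - a)‖ ^ 2) ^ (-p) := by
  refine rpow_le_rpow_of_nonpos (by positivity) ?_ (by linarith)
  have := sq_norm_fin_two_le (u • (y - a))
  simp only [Pi.smul_apply, Pi.sub_apply, smul_eq_mul, mul_pow] at this
  linarith

theorem integrable_rescaled_profile {α u : ℝ} (hα : 2 < α) (hu : 0 < u) (a : Fin 2 → ℝ) :
    Integrable fun y : Fin 2 → ℝ => (1 + ‖u • (y - a)‖ ^ 2) ^ (-α / 2) := by
  have h : Integrable fun y : Fin 2 → ℝ => (1 + ‖y‖ ^ 2) ^ (-α / 2) :=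
    integrable_rpow_neg_one_add_norm_sq (by simpa using hα)
  exact (h.comp_smul hu.ne').comp_sub_right a

theorem integral_rescaled_profile {u : ℝ} (hu : 0 < u) (f : (Fin 2 → ℝ) → ℝ) (a : Fin 2 → ℝ) :
    u ^ 2 * ∫ y, f (u • (y - a)) = ∫ y, f y := by
  rw [integral_sub_right_eq_self (fun y => f (u • y)) a, Measure.integral_comp_smul]
  rw [Module.finrank_fin_fun, abs_of_pos (by positivity), smul_eq_mul]
  field_simp

/-- Unbalanced high-order bubble interaction estimate on `ℝ²`: for `α + β = 4` with
`α > 2 > β > 1` there is `C > 0` (depending only on `β`) such that for all `λ₁ ≥ λ₂ > 0` and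
`a₁, a₂ ∈ ℝ²`,
`∫_{ℝ²} (λ₁/(1+λ₁²|y−a₁|²))^{α/2} (λ₂/(1+λ₂²|y−a₂|²))^{β/2} dy ≤ C ε₁₂^β`, where
`ε₁₂ = (λ₁/λ₂ + λ₂/λ₁ + λ₁λ₂|a₁−a₂|²)^{−1/2}`. -/
theorem stmt_18 (α β : ℝ) (hab : α + β = 4) (ha : 2 < α) (hb1 : β < 2) (hb2 : 1 < β) :
    ∃ C : ℝ, 0 < C ∧
      ∀ lam₁ lam₂ : ℝ, 0 < lam₂ → lam₂ ≤ lam₁ → ∀ a₁ a₂ : Fin 2 → ℝ,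
        (∫ y : Fin 2 → ℝ,
            (lam₁ / (1 + lam₁ ^ 2 * ((y 0 - a₁ 0) ^ 2 + (y 1 - a₁ 1) ^ 2))) ^ (α / 2) *
              (lam₂ / (1 + lam₂ ^ 2 * ((y 0 - a₂ 0) ^ 2 + (y 1 - a₂ 1) ^ 2))) ^ (β / 2)) ≤
          C * ((lam₁ / lam₂ + lam₂ / lam₁ +
              lam₁ * lam₂ * ((a₁ 0 - a₂ 0) ^ 2 + (a₁ 1 - a₂ 1) ^ 2)) ^ (-(1 : ℝ) / 2)) ^ β := by
  set J := ∫ y : Fin 2 → ℝ, (1 + ‖y‖ ^ 2) ^ (-α / 2) with hJ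
  have hJ0 : 0 ≤ J := integral_nonneg fun y => by positivity
  refine ⟨4 ^ (β / 2) * (2 * J) + 1, by positivity, fun u v hv hvu a₁ a₂ => ?_⟩
  have hu : 0 < u := hv.trans_le hvu
  set E := u / v + v / u + u * v * ((a₁ 0 - a₂ 0) ^ 2 + (a₁ 1 - a₂ 1) ^ 2) with hE
  have hEpos : 0 < E := by positivity
  have hEβ : (E ^ (-(1 : ℝ) / 2)) ^ β = E ^ (-(β / 2)) := by
    rw [← rpow_mul hEpos.le]; ring_nf
  rw [hEβ]
  have hEq : 0 < E ^ (-(β / 2)) := rpow_pos_of_pos hEpos _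
  have hi₁ := integrable_rescaled_profile ha hu a₁
  have hi₂ := integrable_rescaled_profile ha hu a₂
  have hle : ∀ y : Fin 2 → ℝ,
      (u / (1 + u ^ 2 * ((y 0 - a₁ 0) ^ 2 + (y 1 - a₁ 1) ^ 2))) ^ (α / 2) *
          (v / (1 + v ^ 2 * ((y 0 - a₂ 0) ^ 2 + (y 1 - a₂ 1) ^ 2))) ^ (β / 2) ≤
        4 ^ (β / 2) * E ^ (-(β / 2)) * (u ^ 2 *
          ((1 + ‖u • (y - a₁)‖ ^ 2) ^ (-α / 2) + (1 + ‖u • (y - a₂)‖ ^ 2) ^ (-α / 2))) := by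
    intro y
    refine (bubble_mul_bubble_le_s18 (d := (a₁ 0 - a₂ 0) ^ 2 + (a₁ 1 - a₂ 1) ^ 2) (by linarith)
      (by linarith) (by linarith) hv hvu (by positivity) (by positivity) (by positivity) ?_).trans ?_
    · nlinarith [sq_nonneg (y 0 - a₁ 0 + (y 0 - a₂ 0)), sq_nonneg (y 1 - a₁ 1 + (y 1 - a₂ 1))]
    · rw [neg_div]
      gcongr 4 ^ (β / 2) * _ * (u ^ 2 * (?_ + ?_))
      · exact rpow_neg_le_sup_norm (by linarith) u y a₁
      · exact rpow_neg_le_sup_norm (by linarith) u y a₂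
  calc _ ≤ ∫ y : Fin 2 → ℝ, 4 ^ (β / 2) * E ^ (-(β / 2)) * (u ^ 2 *
          ((1 + ‖u • (y - a₁)‖ ^ 2) ^ (-α / 2) + (1 + ‖u • (y - a₂)‖ ^ 2) ^ (-α / 2))) :=
        integral_mono_of_nonneg (.of_forall fun y => by positivity)
          (((hi₁.add hi₂).const_mul _).const_mul _) (.of_forall hle)
    _ = 4 ^ (β / 2) * (2 * J) * E ^ (-(β / 2)) := by
        rw [integral_const_mul, integral_const_mul, integral_add hi₁ hi₂, mul_add,
          integral_rescaled_profile hu (fun y => (1 + ‖y‖ ^ 2) ^ (-α / 2)),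
          integral_rescaled_profile hu (fun y => (1 + ‖y‖ ^ 2) ^ (-α / 2)), ← hJ]
        ring
    _ ≤ _ := by gcongr; linarith
end
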